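/- Let n ≥ 5 with n = 2^r + 2 for some natural number r and n = p^s + 1 for some odd prime p and s ≥ 1. Then every proper subgroup H of the alternating group A_n satisfies exp(H) ≠ exp(A_n). -/

import Mathlib

open Equiv.Perm MulAction

theorem exists_prime_of_two_pow_add_one_eq_prime_pow {r p s : ℕ} (hr : 3 ≤ r) (hp : p.Prime)
    (h : 2 ^ r + 1 = p ^ s) : ∃ q, q.Prime ∧ q < 2 ^ r ∧ 2 ^ r + 2 < 2 * q := by
  obtain ⟨m, rfl⟩ : ∃ m, r = m + 3 := ⟨r - 3, by omega⟩
  obtain rfl | hm := Nat.eq_zero_or_pos m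
  · exact ⟨7, by norm_num⟩
  obtain ⟨q, hq, hlt, hle⟩ := Nat.exists_prime_lt_and_le_two_mul (2 ^ (m + 2)) (by positivity)
  have hpow : 2 ^ (m + 3) = 2 * 2 ^ (m + 2) := by ring
  have h2m : 2 ≤ 2 ^ m := Nat.le_self_pow hm.ne' 2
  have h4 : 2 ^ (m + 2) = 4 * 2 ^ m := by ring
  have hqodd : Odd q := hq.odd_of_ne_two (by omega)
  have hqne : q ≠ 2 ^ (m + 2) + 1 := by
    intro hqe
    rcases Nat.even_or_odd m with ⟨k, rfl⟩ | ⟨k, rfl⟩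
    · -- the exponent is odd, so `p = 3`, and `2 ^ r + 1` is no power of `3`
      have h3 : 3 ∣ p ^ s := by
        rw [← h, show 2 ^ (k + k + 3) = 4 ^ k * 8 by rw [← two_mul, pow_add, pow_mul]; norm_num]
        simp [Nat.dvd_iff_mod_eq_zero, Nat.add_mod, Nat.mul_mod, Nat.pow_mod]
      have hp3 : 3 = p := (Nat.prime_dvd_prime_iff_eq Nat.prime_three hp).1
        (Nat.prime_three.dvd_of_dvd_pow h3)
      subst hp3
      have h16 : 3 ^ s % 16 = 1 := by
        have h8 : 2 ^ (k + k + 3) = 16 * 2 ^ (k + k - 1) := by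
          rw [show k + k + 3 = 4 + (k + k - 1) by omega, pow_add]; norm_num
        omega
      have h5 : 5 ∣ 2 ^ (k + k + 3) := by
        have hs := Nat.div_add_mod s 4
        have hs4 : s % 4 < 4 := Nat.mod_lt _ (by norm_num)
        rw [← hs, pow_add 3, pow_mul 3] at h16 h
        have h81 : (3 ^ 4) ^ (s / 4) % 80 = 1 := by simp [Nat.pow_mod]
        interval_cases s % 4 <;> omega
      have := Nat.le_of_dvd (by norm_num) (Nat.prime_five.dvd_of_dvd_pow h5)
      omega
    · have h3 : 3 ∣ q := by
        rw [hqe, show 2 ^ (2 * k + 1 + 2) = 4 ^ k * 8 by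
          rw [show 2 * k + 1 + 2 = 2 * k + 3 by ring, pow_add, pow_mul]; norm_num]
        simp [Nat.dvd_iff_mod_eq_zero, Nat.add_mod, Nat.mul_mod, Nat.pow_mod]
      have := (Nat.prime_dvd_prime_iff_eq Nat.prime_three hq).1 h3
      omega
  obtain ⟨t, rfl⟩ := hqodd
  exact ⟨_, hq, by omega, by omega⟩

/-- Witt's lemma for a cycle `σ` of prime length: if `K` is transitive on tuples of points outside
the support of `σ`, then every permutation of these points is induced by an element of `K`
normalizing the subgroup generated by `σ`. -/
theorem Equiv.Perm.IsCycle.exists_conj_mem_zpowers_of_isMultiplyPretransitive {α : Type*}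
    [Fintype α] [DecidableEq α] {K : Subgroup (Equiv.Perm α)} {σ : Equiv.Perm α}
    (hprime : σ.support.card.Prime) (hcyc : σ.IsCycle) (hσ : σ ∈ K)
    (htrans : IsMultiplyPretransitive K α (Fintype.card α - σ.support.card))
    {π : Equiv.Perm α} (hπ : ∀ x ∉ σ.support, π x ∉ σ.support) :
    ∃ h ∈ K, (∀ x ∉ σ.support, h x = π x) ∧ h * σ * h⁻¹ ∈ Subgroup.zpowers σ := by
  set q := σ.support.card with hq
  have : Fact q.Prime := ⟨hprime⟩
  have hqle : q ≤ Fintype.card α := Finset.card_le_univ _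
  let Δ : Set α := (σ.support : Set α)ᶜ
  have hΔ : Δ.ncard = Fintype.card α - q := by
    rw [Set.ncard_compl, Set.ncard_coe_finset, Nat.card_eq_fintype_card]
  let F := fixingSubgroup K Δ
  have hcard : Nat.card F ∣ q.factorial := by
    have hidx := htrans.index_of_fixingSubgroup_mul hΔ
    rw [Nat.card_eq_fintype_card, Nat.sub_sub_self hqle] at hidx
    have hK : Nat.card K ∣ (Fintype.card α).factorial := by
      rw [← Fintype.card_perm, ← Nat.card_eq_fintype_card]
      exact Subgroup.card_subgroup_dvd_card K
    rw [← hidx, ← Subgroup.index_mul_card F] at hK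
    exact Nat.dvd_of_mul_dvd_mul_left (Nat.pos_of_ne_zero Subgroup.index_ne_zero_of_finite) hK
  have hfact : q.factorial.factorization q = 1 := by
    rw [← Nat.mul_factorial_pred hprime.ne_zero, Nat.factorization_mul hprime.ne_zero
      (Nat.factorial_ne_zero _), Finsupp.add_apply, hprime.factorization_self,
      Nat.factorization_eq_zero_of_not_dvd]
    rw [hprime.dvd_factorial]
    have := hprime.pos
    omega
  have hsylow (x : F) (hx : orderOf x = q) :
      Nat.card (Subgroup.zpowers x) = q ^ (Nat.card F).factorization q := by
    rw [Nat.card_zpowers, hx]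
    have h1 : 1 ≤ (Nat.card F).factorization q := by
      rw [← hprime.pow_dvd_iff_le_factorization Nat.card_pos.ne', pow_one, ← hx]
      exact orderOf_dvd_natCard x
    have h2 : (Nat.card F).factorization q ≤ 1 := hfact ▸
      (Nat.factorization_le_iff_dvd Nat.card_pos.ne' (Nat.factorial_ne_zero _)).2 hcard q
    rw [le_antisymm h2 h1, pow_one]
  obtain ⟨k, hk⟩ : ∃ k : K, ∀ x ∈ Δ, k.1 x = π x := by
    let e : Fin (Fintype.card α - q) ≃ Δ := (Finite.equivFinOfCardEq hΔ).symm
    let x : Fin (Fintype.card α - q) ↪ α := e.toEmbedding.trans (Function.Embedding.subtype _)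
    obtain ⟨k, hk⟩ := isMultiplyPretransitive_iff.1 htrans x (x.trans π.toEmbedding)
    refine ⟨k, fun y hy ↦ ?_⟩
    have := DFunLike.congr_fun hk (e.symm ⟨y, hy⟩)
    simpa [x, Subgroup.smul_def] using this
  let s : K := ⟨σ, hσ⟩
  have hs : s ∈ F := by
    rw [mem_fixingSubgroup_iff]
    intro y hy
    simpa [Δ, s, Subgroup.smul_def] using hy
  have ht : k⁻¹ * s * k ∈ F := by
    rw [mem_fixingSubgroup_iff]
    intro y hy
    have : σ (k.1 y) = k.1 y := by
      rw [hk y hy]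
      simpa using hπ y (by simpa [Δ] using hy)
    simp [s, Subgroup.smul_def, this]
  have hos : orderOf (⟨s, hs⟩ : F) = q := by
    rw [Subgroup.orderOf_mk, Subgroup.orderOf_mk, hcyc.orderOf]
  have hot : orderOf (⟨k⁻¹ * s * k, ht⟩ : F) = q := by
    calc orderOf (⟨k⁻¹ * s * k, ht⟩ : F) = orderOf (k⁻¹ * s * k) := Subgroup.orderOf_mk _ _
      _ = orderOf s := by simpa only [MulAut.conj_apply, inv_inv] using
        (MulAut.conj k⁻¹).orderOf_eq s
      _ = q := by rw [Subgroup.orderOf_mk, hcyc.orderOf]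
  obtain ⟨f, hf⟩ := exists_smul_eq F (Sylow.ofCard _ (hsylow _ hos)) (Sylow.ofCard _ (hsylow _ hot))
  have hmem : f * ⟨s, hs⟩ * f⁻¹ ∈ Subgroup.zpowers (⟨k⁻¹ * s * k, ht⟩ : F) := by
    have := congrArg (fun P : Sylow q F ↦ f * ⟨s, hs⟩ * f⁻¹ ∈ P.toSubgroup) hf
    refine this.mp ?_
    exact Subgroup.smul_mem_pointwise_smul _ (MulAut.conj f) _ (Subgroup.mem_zpowers _)
  obtain ⟨j, hj⟩ := Subgroup.mem_zpowers_iff.1 hmem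
  have hj' : (k.1⁻¹ * σ * k.1) ^ j = f.1.1 * σ * f.1.1⁻¹ := by
    simpa [s] using congrArg (fun x : F ↦ x.1.1) hj
  refine ⟨k.1 * f.1.1, K.mul_mem k.2 f.1.2, fun x hx ↦ ?_, ?_⟩
  · have hx' : x ∈ Δ := by simpa [Δ] using hx
    have hfx : f.1.1 x = x := (mem_fixingSubgroup_iff _).1 f.2 x hx'
    rw [mul_apply, hfx, hk x hx']
  · refine Subgroup.mem_zpowers_iff.2 ⟨j, ?_⟩
    have : (k.1⁻¹ * σ * k.1) ^ j = k.1⁻¹ * σ ^ j * k.1 := by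
      simpa using (conj_zpow (a := k.1⁻¹) (b := σ) (i := j))
    rw [this] at hj'
    rw [show k.1 * f.1.1 * σ * (k.1 * f.1.1)⁻¹ = k.1 * (f.1.1 * σ * f.1.1⁻¹) * k.1⁻¹ by group,
      ← hj']
    group

/-- A primitive permutation group containing a cycle of prime length that fixes at least three
points contains the alternating group (Jordan). -/
theorem Equiv.Perm.alternatingGroup_le_of_isPreprimitive_of_isCycle_mem {α : Type*}
    [Fintype α] [DecidableEq α] {K : Subgroup (Equiv.Perm α)} (hK : IsPreprimitive K α)
    {σ : Equiv.Perm α} (hprime : σ.support.card.Prime) (hcyc : σ.IsCycle) (hσ : σ ∈ K)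
    (hcard : σ.support.card + 3 ≤ Fintype.card α) : alternatingGroup α ≤ K := by
  have htrans : IsMultiplyPretransitive K α (Fintype.card α - σ.support.card) := by
    obtain ⟨m, hm⟩ := Nat.exists_eq_add_of_le hcard
    have hn : ((σ.support : Set α)ᶜ).ncard = (m + 2) + 1 := by
      rw [Set.ncard_compl, Set.ncard_coe_finset, Nat.card_eq_fintype_card]
      omega
    have hprim : IsPreprimitive (fixingSubgroup K (σ.support : Set α)ᶜ)
        (SubMulAction.ofFixingSubgroup K (σ.support : Set α)ᶜ) := by
      have := isPretransitive_of_isCycle_mem hcyc hσ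
      apply IsPreprimitive.of_prime_card
      convert! hprime
      rw [← Nat.card_eq_finsetCard]
      exact Nat.card_congr (Equiv.subtypeEquivRight fun x ↦ by
        simp [SubMulAction.mem_ofFixingSubgroup_iff])
    have hmp := hK.isMultiplyPreprimitive hn
      (by rw [Nat.card_eq_fintype_card]; have := hprime.two_le; omega) hprim
    have := hmp.isMultiplyPretransitive
    exact isMultiplyPretransitive_of_le (n := m + 2 + 2) (by omega)
      (by rw [Nat.card_eq_fintype_card]; have := hprime.two_le; omega)
  obtain ⟨x, y, z, hx, hy, hz, hxy, hxz, hyz⟩ :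
      ∃ x y z, x ∈ σ.supportᶜ ∧ y ∈ σ.supportᶜ ∧ z ∈ σ.supportᶜ ∧ x ≠ y ∧ x ≠ z ∧ y ≠ z :=
    Finset.two_lt_card_iff.1 (by rw [Finset.card_compl]; omega)
  rw [Finset.mem_compl] at hx hy hz
  have hswap {a b : α} (ha : a ∉ σ.support) (hb : b ∉ σ.support) :
      ∀ w ∉ σ.support, Equiv.swap a b w ∉ σ.support := by
    intro w hw
    rw [Equiv.swap_apply_def]
    split_ifs <;> assumption
  obtain ⟨h₁, hh₁, hΔ₁, hc₁⟩ :=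
    hcyc.exists_conj_mem_zpowers_of_isMultiplyPretransitive hprime hσ htrans (hswap hx hy)
  obtain ⟨h₂, hh₂, hΔ₂, hc₂⟩ :=
    hcyc.exists_conj_mem_zpowers_of_isMultiplyPretransitive hprime hσ htrans (hswap hx hz)
  obtain ⟨a, ha⟩ := Subgroup.mem_zpowers_iff.1 hc₁
  obtain ⟨b, hb⟩ := Subgroup.mem_zpowers_iff.1 hc₂
  have hcomm : Commute ((h₂ * h₁)⁻¹ * (h₁ * h₂)) σ := by
    have e₁ : (h₁ * h₂) * σ * (h₁ * h₂)⁻¹ = σ ^ (a * b) := by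
      rw [mul_inv_rev, zpow_mul, ha, conj_zpow, hb]
      group
    have e₂ : (h₂ * h₁) * σ * (h₂ * h₁)⁻¹ = σ ^ (a * b) := by
      rw [mul_inv_rev, mul_comm a, zpow_mul, hb, conj_zpow, ha]
      group
    rw [← e₂] at e₁
    have := congrArg (fun t ↦ (h₂ * h₁)⁻¹ * t * (h₁ * h₂)) e₁
    simp only [mul_assoc, inv_mul_cancel, mul_one] at this
    rw [commute_iff_eq]
    simpa [mul_assoc] using this
  set w := (h₂ * h₁)⁻¹ * (h₁ * h₂) with hw
  have hwK : w ∈ K := K.mul_mem (K.inv_mem (K.mul_mem hh₂ hh₁)) (K.mul_mem hh₁ hh₂)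
  set ρ := Equiv.swap x y * Equiv.swap x z with hρ
  have hwρ : ∀ d ∉ σ.support, w d = (ρ * ρ) d := by
    intro d hd
    have h₁₂ : ∀ d ∉ σ.support, (h₁ * h₂) d = ρ d := fun d hd ↦ by
      rw [mul_apply, hΔ₂ d hd, hΔ₁ _ (hswap hx hz d hd), hρ, mul_apply]
    have h₂₁ : ∀ d ∉ σ.support, (h₂ * h₁) d = ρ⁻¹ d := fun d hd ↦ by
      rw [mul_apply, hΔ₁ d hd, hΔ₂ _ (hswap hx hy d hd), hρ, mul_inv_rev, mul_apply,
        Equiv.swap_inv, Equiv.swap_inv]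
    have hρd : ∀ d ∉ σ.support, ρ d ∉ σ.support := fun d hd ↦ by
      rw [hρ, mul_apply]
      exact hswap hx hy _ (hswap hx hz d hd)
    rw [hw, mul_apply, h₁₂ d hd, inv_eq_iff_eq, h₂₁ _ (by rw [mul_apply]; exact hρd _ (hρd _ hd))]
    simp
  obtain ⟨u, hu⟩ := hcyc.nonempty_support
  have hwu : w u ∈ σ.support := by
    rw [mem_support] at hu ⊢
    rw [← mul_apply, ← hcomm.eq, mul_apply]
    exact fun h ↦ hu (w.injective h)
  obtain ⟨i, hi⟩ := hcyc.exists_zpow_eq (mem_support.1 hu) (mem_support.1 hwu)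
  have hρsupp : ∀ d ∈ σ.support, ρ d = d := fun d hd ↦ by
    have hne : ∀ e ∉ σ.support, d ≠ e := fun e he h ↦ he (h ▸ hd)
    rw [hρ, mul_apply, Equiv.swap_apply_of_ne_of_ne (hne _ hx) (hne _ hz),
      Equiv.swap_apply_of_ne_of_ne (hne _ hx) (hne _ hy)]
  have hkey : σ ^ (-i) * w = ρ * ρ := by
    ext d
    by_cases hd : d ∈ σ.support
    · obtain ⟨m, rfl⟩ := hcyc.exists_zpow_eq (mem_support.1 hu) (mem_support.1 hd)
      rw [mul_apply ρ, hρsupp _ hd, hρsupp _ hd]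
      have : w ((σ ^ m) u) = (σ ^ m) (w u) := by
        rw [← mul_apply, (hcomm.zpow_right m).eq, mul_apply]
      rw [mul_apply, this, ← hi]
      simp only [← mul_apply, ← zpow_add]
      congr 2
      ring_nf
    · rw [mul_apply, hwρ d hd, ← hwρ d hd]
      have : w d ∉ σ.support := by
        rw [notMem_support] at hd ⊢
        rw [← mul_apply, ← hcomm.eq, mul_apply, hd]
      rw [zpow_apply_eq_self_of_apply_eq_self (notMem_support.1 this)]
  refine alternatingGroup_le_of_isPreprimitive_of_isThreeCycle_mem hK
    (isThreeCycle_swap_mul_swap_same hxy hxz hyz).isThreeCycle_sq ?_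
  rw [← hρ, ← hkey]
  exact K.mul_mem (K.zpow_mem hσ _) hwK

theorem Monoid.exists_orderOf_eq_prime_pow_of_dvd_exponent {G : Type*} [Monoid G] {p k : ℕ}
    (hp : p.Prime) (hG : Monoid.exponent G ≠ 0) (h : p ^ k ∣ Monoid.exponent G) :
    ∃ g : G, orderOf g = p ^ k := by
  obtain ⟨g, hg⟩ := hp.exists_orderOf_eq_pow_factorization_exponent G
  have hne : orderOf g ≠ 0 := by rw [hg]; exact pow_ne_zero _ hp.ne_zero
  refine ⟨g ^ (orderOf g / p ^ k), orderOf_pow_orderOf_div hne ?_⟩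
  rw [hg]
  exact pow_dvd_pow p ((hp.pow_dvd_iff_le_factorization hG).1 h)

theorem Equiv.Perm.prime_pow_mem_cycleType_of_orderOf_eq {α : Type*} [Fintype α] [DecidableEq α]
    {p k : ℕ} (hp : p.Prime) (hk : k ≠ 0) {g : Equiv.Perm α} (hg : orderOf g = p ^ k) :
    p ^ k ∈ g.cycleType := by
  by_contra hmem
  obtain ⟨k, rfl⟩ := Nat.exists_eq_succ_of_ne_zero hk
  have : g.cycleType.lcm ∣ p ^ k := by
    refine Multiset.lcm_dvd.2 fun a ha ↦ ?_
    obtain ⟨i, hi, rfl⟩ := (Nat.dvd_prime_pow hp).1 (hg ▸ dvd_of_mem_cycleType ha)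
    refine pow_dvd_pow p (Nat.le_of_lt_succ (lt_of_le_of_ne hi ?_))
    rintro rfl
    exact hmem ha
  rw [lcm_cycleType, hg, Nat.pow_dvd_pow_iff_le_right hp.one_lt] at this
  omega

theorem lcm_dvd_exponent_alternatingGroup {α : Type*} [Fintype α] [DecidableEq α]
    {m : Multiset ℕ} (hsum : m.sum ≤ Fintype.card α) (htwo : ∀ a ∈ m, 2 ≤ a)
    (heven : Even (m.sum + m.card)) : m.lcm ∣ Monoid.exponent (alternatingGroup α) := by
  obtain ⟨g, rfl⟩ := (exists_with_cycleType_iff α).2 ⟨hsum, htwo⟩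
  have hg : g ∈ alternatingGroup α := by
    rw [mem_alternatingGroup, sign_of_cycleType, heven.neg_one_pow]
  rw [lcm_cycleType, ← Subgroup.orderOf_mk g hg]
  exact Monoid.order_dvd_exponent _

theorem Equiv.Perm.isMultiplyPretransitive_two_of_isCycle_mem {α : Type*} [Fintype α]
    [DecidableEq α] {K : Subgroup (Equiv.Perm α)} {c g : Equiv.Perm α} (hc : c.IsCycle)
    (hcK : c ∈ K) (hcard : c.support.card + 1 = Fintype.card α) (hgK : g ∈ K)
    (hg : g.support = Finset.univ) : IsMultiplyPretransitive K α 2 := by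
  obtain ⟨a, ha⟩ : ∃ a, c.supportᶜ = {a} :=
    Finset.card_eq_one.1 (by rw [Finset.card_compl]; omega)
  have hmem : ∀ x, x ≠ a → x ∈ c.support := fun x hx ↦ by
    by_contra h
    rw [← Finset.mem_compl, ha, Finset.mem_singleton] at h
    exact hx h
  have hca : c a = a := by
    rw [← notMem_support, ← Finset.mem_compl, ha, Finset.mem_singleton]
  have hrot : ∀ x y, x ≠ a → y ≠ a → ∃ k : stabilizer K a, k.1.1 x = y := fun x y hx hy ↦ by
    obtain ⟨i, hi⟩ := hc.exists_zpow_eq (mem_support.1 (hmem x hx)) (mem_support.1 (hmem y hy))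
    exact ⟨⟨⟨c ^ i, K.zpow_mem hcK i⟩, zpow_apply_eq_self_of_apply_eq_self hca i⟩, hi⟩
  have hga : g a ≠ a := mem_support.1 (hg ▸ Finset.mem_univ a)
  have : IsPretransitive K α := by
    refine IsPretransitive.of_orbit (x₀ := a) fun x ↦ ?_
    by_cases hx : x = a
    · exact hx ▸ mem_orbit_self a
    · obtain ⟨k, hk⟩ := hrot _ x hga hx
      exact ⟨k.1 * ⟨g, hgK⟩, hk⟩
  rw [SubMulAction.ofStabilizer.isMultiplyPretransitive (n := 1) (a := a), is_one_pretransitive_iff]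
  refine ⟨fun x y ↦ ?_⟩
  obtain ⟨k, hk⟩ := hrot x y x.2 y.2
  exact ⟨k, Subtype.ext hk⟩

theorem card_support_swaps_eq_three : ∀ u v w x : Fin 6, [u, v, w, x, 0, 1].Nodup →
    ((c[0, 1, 2, 3] * c[4, 5] : Equiv.Perm (Fin 6))⁻¹ * (Equiv.swap u w * Equiv.swap v x) *
      (c[0, 1, 2, 3] * c[4, 5]) * (Equiv.swap u w * Equiv.swap v x)).support.card = 3 := by
  decide

theorem alternatingGroup_le_of_isMultiplyPretransitive_two_of_cycleType_eq
    {K : Subgroup (Equiv.Perm (Fin 6))} (hK : IsMultiplyPretransitive K (Fin 6) 2)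
    {g : Equiv.Perm (Fin 6)} (hgK : g ∈ K) (hg : g.cycleType = {4, 2}) :
    alternatingGroup (Fin 6) ≤ K := by
  set g₀ : Equiv.Perm (Fin 6) := c[0, 1, 2, 3] * c[4, 5] with hg₀
  have hg₀sq : g₀ * g₀ = Equiv.swap 0 2 * Equiv.swap 1 3 := by decide
  have hct : g₀.cycleType = {4, 2} := by
    decide
  obtain ⟨σ, rfl⟩ := isConj_iff.1 (isConj_iff_cycleType_eq.2 (hct.trans hg.symm))
  obtain ⟨⟨h, hhK⟩, h4, h5⟩ := is_two_pretransitive_iff.1 hK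
    (σ.injective.ne (show (4 : Fin 6) ≠ 5 by decide))
    (σ.injective.ne (show (0 : Fin 6) ≠ 1 by decide))
  set k := σ⁻¹ * h * σ with hk
  have hk4 : k 4 = 0 := σ.symm_apply_eq.2 h4
  have hk5 : k 5 = 1 := σ.symm_apply_eq.2 h5
  set t := k * (g₀ * g₀) * k⁻¹ with ht
  have ht' : t = Equiv.swap (k 0) (k 2) * Equiv.swap (k 1) (k 3) := by
    rw [ht, hg₀sq, Equiv.swap_apply_apply, Equiv.swap_apply_apply]
    group
  have h3 : (g₀⁻¹ * t * g₀ * t).support.card = 3 := by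
    rw [ht']
    refine card_support_swaps_eq_three _ _ _ _ ?_
    have hmap : [k 0, k 1, k 2, k 3, 0, 1] = [(0 : Fin 6), 1, 2, 3, 4, 5].map k := by
      simp [hk4, hk5]
    rw [hmap]
    exact List.Nodup.map k.injective (show [(0 : Fin 6), 1, 2, 3, 4, 5].Nodup by decide)
  have hmem : σ * (g₀⁻¹ * t * g₀ * t) * σ⁻¹ ∈ K := by
    have : σ * (g₀⁻¹ * t * g₀ * t) * σ⁻¹ = (σ * g₀ * σ⁻¹)⁻¹ *
        (h * ((σ * g₀ * σ⁻¹) * (σ * g₀ * σ⁻¹)) * h⁻¹) * (σ * g₀ * σ⁻¹) *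
        (h * ((σ * g₀ * σ⁻¹) * (σ * g₀ * σ⁻¹)) * h⁻¹) := by
      rw [ht, hk]
      group
    rw [this]
    have ht := K.mul_mem (K.mul_mem hhK (K.mul_mem hgK hgK)) (K.inv_mem hhK)
    exact K.mul_mem (K.mul_mem (K.mul_mem (K.inv_mem hgK) ht) hgK) ht
  refine alternatingGroup_le_of_isPreprimitive_of_isThreeCycle_mem
    (isPreprimitive_of_is_two_pretransitive hK) ?_ hmem
  rwa [← card_support_eq_three_iff, card_support_conj]

/-- If `n ≥ 5` satisfies `n = 2^r + 2` and `n = p^s + 1` for an odd prime `p` and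
`s ≥ 1`, then no proper subgroup of `A_n` has the same exponent as `A_n`. -/
theorem alternatingGroup_no_proper_subgroup_same_exponent_of_two_pow_add_two
    (n r p s : ℕ) (hn : 5 ≤ n) (hnr : n = 2 ^ r + 2)
    (hp : p.Prime) (hodd : Odd p) (hs : 1 ≤ s) (hnp : n = p ^ s + 1) :
    ∀ H : Subgroup (alternatingGroup (Fin n)), H ≠ ⊤ →
      Monoid.exponent H ≠ Monoid.exponent (alternatingGroup (Fin n)) := by
  intro H hH hexp
  refine hH ?_
  set K : Subgroup (Equiv.Perm (Fin n)) := H.map (alternatingGroup (Fin n)).subtype with hKdef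
  suffices hle : alternatingGroup (Fin n) ≤ K by
    refine (Subgroup.eq_top_iff' H).2 fun x ↦ ?_
    obtain ⟨y, hy, hyx⟩ := hle x.2
    exact Subtype.ext hyx ▸ hy
  have hr : 2 ≤ r := by
    by_contra! h
    interval_cases r <;> omega
  have h4 : 4 ≤ 2 ^ r := Nat.pow_le_pow_right two_pos hr
  have horder {ℓ k : ℕ} (hℓ : ℓ.Prime) (hdvd : ℓ ^ k ∣ Monoid.exponent (alternatingGroup (Fin n))) :
      ∃ g ∈ K, orderOf g = ℓ ^ k ∧ sign g = 1 := by
    obtain ⟨g, hg⟩ := Monoid.exists_orderOf_eq_prime_pow_of_dvd_exponent (G := H) hℓ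
      Monoid.exponent_ne_zero_of_finite (hexp ▸ hdvd)
    exact ⟨g.1.1, ⟨g.1, g.2, rfl⟩, by rw [Subgroup.orderOf_coe, Subgroup.orderOf_coe, hg], g.1.2⟩
  have hrest {g : Equiv.Perm (Fin n)} {a : ℕ} (ha : a ∈ g.cycleType) :
      ∃ m : Multiset ℕ, g.cycleType = a ::ₘ m ∧ a + m.sum ≤ n ∧ ∀ b ∈ m, 2 ≤ b := by
    obtain ⟨m, hm⟩ := Multiset.exists_cons_of_mem ha
    refine ⟨m, hm, ?_, fun b hb ↦ two_le_of_mem_cycleType (hm ▸ Multiset.mem_cons_of_mem hb)⟩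
    rw [← Multiset.sum_cons, ← hm]
    simpa using g.sum_cycleType_le
  have hzero {m : Multiset ℕ} (hsum : m.sum ≤ 1) (hm : ∀ b ∈ m, 2 ≤ b) : m = 0 :=
    Multiset.eq_zero_of_forall_notMem fun b hb ↦ by
      have := Multiset.le_sum_of_mem hb
      have := hm b hb
      omega
  have hpsodd : Odd (p ^ s) := hodd.pow
  obtain ⟨c, hcK, hc, hcsupp⟩ :
      ∃ c ∈ K, c.IsCycle ∧ c.support.card + 1 = Fintype.card (Fin n) := by
    obtain ⟨c, hcK, hco, -⟩ := horder (ℓ := p) (k := s) hp (by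
      simpa using lcm_dvd_exponent_alternatingGroup (α := Fin n) (m := {p ^ s})
        (by simp; omega) (by simp; omega) (by simpa using hpsodd.add_one))
    obtain ⟨m, hm, hsum, htwo⟩ := hrest
      (prime_pow_mem_cycleType_of_orderOf_eq hp (by omega : s ≠ 0) hco)
    obtain rfl := hzero (by omega) htwo
    refine ⟨c, hcK, card_cycleType_eq_one.1 (by simp [hm]), ?_⟩
    rw [← sum_cycleType, hm, Fintype.card_fin, hnp]
    simp
  obtain ⟨g, hgK, hg⟩ : ∃ g ∈ K, g.cycleType = {2 ^ r, 2} := by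
    obtain ⟨g, hgK, hgo, hsign⟩ := horder (ℓ := 2) (k := r) Nat.prime_two
      ((Multiset.dvd_lcm (by simp)).trans
        (lcm_dvd_exponent_alternatingGroup (α := Fin n) (m := {2 ^ r, 2})
          (by simp; omega) (by simp; omega) (by simp [Nat.even_add, Nat.even_pow]; omega)))
    obtain ⟨m, hm, hsum, htwo⟩ :=
      hrest (prime_pow_mem_cycleType_of_orderOf_eq Nat.prime_two (by omega) hgo)
    refine ⟨g, hgK, hm.trans ?_⟩
    obtain rfl | ⟨a, ha⟩ := m.empty_or_exists_mem
    · have heven : Even (2 ^ r) := Nat.even_pow.2 ⟨even_two, by omega⟩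
      rw [sign_of_cycleType, hm] at hsign
      simp [heven.add_one.neg_one_pow] at hsign
    · obtain ⟨m, rfl⟩ := Multiset.exists_cons_of_mem ha
      rw [Multiset.sum_cons] at hsum
      have := htwo a ha
      obtain rfl := hzero (m := m) (by omega) fun b hb ↦ htwo b (Multiset.mem_cons_of_mem hb)
      obtain rfl : a = 2 := by omega
      rfl
  have hgsupp : g.support = Finset.univ := by
    rw [← Finset.card_eq_iff_eq_univ, ← sum_cycleType, hg, Fintype.card_fin, hnr]
    simp
  have h2 := isMultiplyPretransitive_two_of_isCycle_mem hc hcK hcsupp hgK hgsupp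
  obtain rfl | hr3 := hr.eq_or_lt
  · norm_num at hnr hg
    subst hnr
    exact alternatingGroup_le_of_isMultiplyPretransitive_two_of_cycleType_eq h2 hgK hg
  obtain ⟨q, hq, hq1, hq2⟩ := exists_prime_of_two_pow_add_one_eq_prime_pow (s := s) hr3 hp
    (by omega)
  have hqodd : Odd q := hq.odd_of_ne_two (by omega)
  obtain ⟨σ, hσK, hσo, -⟩ := horder (ℓ := q) (k := 1) hq (by
    simpa using lcm_dvd_exponent_alternatingGroup (α := Fin n) (m := {q})
      (by simp; omega) (by simp; omega) (by simpa using hqodd.add_one))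
  obtain ⟨m, hm, hsum, htwo⟩ := hrest (prime_pow_mem_cycleType_of_orderOf_eq hq one_ne_zero hσo)
  obtain rfl : m = 0 := Multiset.eq_zero_of_forall_notMem fun b hb ↦ by
    have hbq : b ∣ q := by
      rw [← pow_one q, ← hσo]
      exact dvd_of_mem_cycleType (hm ▸ Multiset.mem_cons_of_mem hb)
    have := (hq.eq_one_or_self_of_dvd b hbq).resolve_left (by have := htwo b hb; omega)
    have := Multiset.le_sum_of_mem hb
    rw [pow_one] at hsum
    omega
  have hσsupp : σ.support.card = q := by
    rw [← sum_cycleType, hm]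
    simp
  refine alternatingGroup_le_of_isPreprimitive_of_isCycle_mem
    (isPreprimitive_of_is_two_pretransitive h2) (hσsupp ▸ hq)
    (card_cycleType_eq_one.1 (by simp [hm])) hσK ?_
  rw [hσsupp, Fintype.card_fin]
  omega
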